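/- arXiv:2210.00701 — 2 statements merged into one kernel-verified Lean document; each statement's English description precedes it below -/
import Mathlib

section
/- Let Φ ⊂ ℝ^d be a finite set of vectors and Π a finite set of policies, each policy π ∈ Π being a probability mass function on Φ. Suppose there exist λ* > 0 and a probability mass function μ̃ on Π with λ_min(V(μ̃)) ≥ λ*. Then every probability mass function μ* on Π for which V(μ*) is positive definite and g(μ*) = max_{π∈Π} Σ_{a∈Φ} π(a) aᵀ V(μ*)⁻¹ a ≤ d satisfies λ_min(V(μ*)) ≥ λ*/d. -/
open Matrix Finset

/-- Cauchy–Schwarz for the dual pair of norms attached to a positive definite matrix. -/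
theorem Matrix.PosDef.sq_dotProduct_le {n : Type*} [Fintype n] [DecidableEq n]
    {V : Matrix n n ℝ} (hV : V.PosDef) (a x : n → ℝ) :
    (a ⬝ᵥ x) ^ 2 ≤ (a ⬝ᵥ (V⁻¹ *ᵥ a)) * (x ⬝ᵥ (V *ᵥ x)) := by
  set y := V⁻¹ *ᵥ a with hy
  have hVy : V *ᵥ y = a := by
    rw [hy, mulVec_mulVec, mul_nonsing_inv V ((isUnit_iff_isUnit_det V).1 hV.isUnit), one_mulVec]
  have hsymm : Vᵀ = V := by simpa using hV.isHermitian.eq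
  have hyx : y ⬝ᵥ (V *ᵥ x) = a ⬝ᵥ x := by
    rw [dotProduct_mulVec, ← mulVec_transpose, hsymm, hVy]
  have key : ∀ t : ℝ,
      0 ≤ (a ⬝ᵥ y) * (t * t) + (2 * (a ⬝ᵥ x)) * t + x ⬝ᵥ (V *ᵥ x) := by
    intro t
    have h := hV.posSemidef.dotProduct_mulVec_nonneg (x + t • y)
    simp only [star_trivial, mulVec_add, mulVec_smul, hVy, add_dotProduct, dotProduct_add,
      smul_dotProduct, dotProduct_smul, smul_eq_mul, hyx] at h
    rw [dotProduct_comm x a, dotProduct_comm y a] at h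
    linarith
  have hdisc := discrim_le_zero key
  rw [discrim] at hdisc
  linarith

/-- The quadratic form of a weighted sum of second-moment matrices. -/
theorem dotProduct_sum_smul_vecMulVec_mulVec {n ι : Type*} [Fintype n] (P : Finset ι)
    (Φ : Finset (n → ℝ)) (μ : ι → ℝ) (p : ι → (n → ℝ) → ℝ) (x : n → ℝ) :
    x ⬝ᵥ ((∑ i ∈ P, μ i • ∑ a ∈ Φ, p i a • vecMulVec a a) *ᵥ x) =
      ∑ i ∈ P, μ i * ∑ a ∈ Φ, p i a * (a ⬝ᵥ x) ^ 2 := by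
  simp only [dotProduct_comm x, sum_mulVec, sum_dotProduct, smul_mulVec, smul_dotProduct,
    smul_eq_mul, vecMulVec_mulVec, op_smul_eq_smul, sq]

/-- Lemma D.2 of Qiao–Wang: if some mixture `μtilde` of policies has design matrix with
smallest eigenvalue at least `lamstar` (expressed via the quadratic form), then any
probability mass function `μstar` whose design matrix `V(μstar)` is positive definite and
satisfies the G-optimality bound `g(μstar) ≤ d` has `λ_min(V(μstar)) ≥ lamstar / d`
(again expressed via the quadratic form). -/
theorem G_optimal_design_min_eigenvalue {d : ℕ} (hd : 1 ≤ d)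
    (Φ : Finset (Fin d → ℝ)) (P : Finset ((Fin d → ℝ) → ℝ))
    (hpmf : ∀ π ∈ P, (∀ a ∈ Φ, 0 ≤ π a) ∧ ∑ a ∈ Φ, π a = 1)
    (lamstar : ℝ) (hlam : 0 < lamstar)
    (μtilde : ((Fin d → ℝ) → ℝ) → ℝ)
    (hμt_nonneg : ∀ π ∈ P, 0 ≤ μtilde π) (hμt_sum : ∑ π ∈ P, μtilde π = 1)
    (hμt_min : ∀ x : Fin d → ℝ,
      lamstar * (x ⬝ᵥ x) ≤ x ⬝ᵥ ((∑ π ∈ P, μtilde π • ∑ a ∈ Φ, π a • vecMulVec a a) *ᵥ x))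
    (μstar : ((Fin d → ℝ) → ℝ) → ℝ)
    (hμs_nonneg : ∀ π ∈ P, 0 ≤ μstar π) (hμs_sum : ∑ π ∈ P, μstar π = 1)
    (hpd : (∑ π ∈ P, μstar π • ∑ a ∈ Φ, π a • vecMulVec a a).PosDef)
    (hg : ∀ π ∈ P,
      ∑ a ∈ Φ, π a *
        (a ⬝ᵥ ((∑ π' ∈ P, μstar π' • ∑ a' ∈ Φ, π' a' • vecMulVec a' a')⁻¹ *ᵥ a)) ≤ d) :
    ∀ x : Fin d → ℝ,
      (lamstar / d) * (x ⬝ᵥ x) ≤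
        x ⬝ᵥ ((∑ π ∈ P, μstar π • ∑ a ∈ Φ, π a • vecMulVec a a) *ᵥ x) := by
  intro x
  set V := ∑ π ∈ P, μstar π • ∑ a ∈ Φ, π a • vecMulVec a a
  have hd' : (0 : ℝ) < d := by exact_mod_cast hd
  have hq : 0 ≤ x ⬝ᵥ (V *ᵥ x) := by simpa using hpd.posSemidef.dotProduct_mulVec_nonneg x
  have hpolicy : ∀ π ∈ P, ∑ a ∈ Φ, π a * (a ⬝ᵥ x) ^ 2 ≤ d * (x ⬝ᵥ (V *ᵥ x)) := by
    intro π hπ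
    calc ∑ a ∈ Φ, π a * (a ⬝ᵥ x) ^ 2
        ≤ ∑ a ∈ Φ, π a * ((a ⬝ᵥ (V⁻¹ *ᵥ a)) * (x ⬝ᵥ (V *ᵥ x))) :=
          sum_le_sum fun a ha =>
            mul_le_mul_of_nonneg_left (hpd.sq_dotProduct_le a x) ((hpmf π hπ).1 a ha)
      _ = (∑ a ∈ Φ, π a * (a ⬝ᵥ (V⁻¹ *ᵥ a))) * (x ⬝ᵥ (V *ᵥ x)) := by
          simp only [sum_mul, mul_assoc]
      _ ≤ d * (x ⬝ᵥ (V *ᵥ x)) := mul_le_mul_of_nonneg_right (hg π hπ) hq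
  have hmix : lamstar * (x ⬝ᵥ x) ≤ d * (x ⬝ᵥ (V *ᵥ x)) := by
    calc lamstar * (x ⬝ᵥ x)
        ≤ ∑ π ∈ P, μtilde π * ∑ a ∈ Φ, π a * (a ⬝ᵥ x) ^ 2 :=
          (hμt_min x).trans_eq (dotProduct_sum_smul_vecMulVec_mulVec P Φ μtilde (fun π => π) x)
      _ ≤ ∑ π ∈ P, μtilde π * (d * (x ⬝ᵥ (V *ᵥ x))) :=
          sum_le_sum fun π hπ => mul_le_mul_of_nonneg_left (hpolicy π hπ) (hμt_nonneg π hπ)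
      _ = d * (x ⬝ᵥ (V *ᵥ x)) := by rw [← sum_mul, hμt_sum, one_mul]
  rw [div_mul_eq_mul_div, div_le_iff₀ hd']
  linarith
end

section
/- Let Φ ⊂ ℝ^d be a finite set of vectors with ‖a‖₂ ≤ 1 for all a ∈ Φ, and let ν_1, ..., ν_t be probability mass functions on Φ. Define Σ_0 = 0 and Σ_i = Σ_{j=1}^i E_{a∼ν_j}[a aᵀ] for i ≥ 1. Then Σ_{i=1}^t E_{a∼ν_i}[ √( aᵀ (I_d + Σ_{i-1})⁻¹ a ) ] ≤ √( 2 d t log(1 + t/d) ). -/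
open Matrix Finset

theorem Finset.one_add_sum_le_prod_one_add_of_nonneg {ι : Type*} (s : Finset ι) {f : ι → ℝ}
    (hf : ∀ i ∈ s, 0 ≤ f i) : 1 + ∑ i ∈ s, f i ≤ ∏ i ∈ s, (1 + f i) := by
  classical
  induction s using Finset.induction_on with
  | empty => simp
  | insert a s ha ih =>
    have hs := fun i hi => hf i (mem_insert_of_mem hi)
    rw [sum_insert ha, prod_insert ha]
    nlinarith [ih hs, sum_nonneg hs, hf a (mem_insert_self a s)]

theorem Matrix.posSemidef_sum_smul_vecMulVec {n ι : Type*} [Fintype n] (s : Finset ι)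
    (w : ι → ℝ) (v : ι → n → ℝ) (hw : ∀ i ∈ s, 0 ≤ w i) :
    (∑ i ∈ s, w i • vecMulVec (v i) (v i)).PosSemidef :=
  posSemidef_sum s fun i hi => by
    simpa using (posSemidef_vecMulVec_self_star (v i)).smul (hw i hi)

theorem Matrix.trace_mul_sum_smul_vecMulVec {n ι : Type*} [Fintype n] (s : Finset ι)
    (w : ι → ℝ) (v : ι → n → ℝ) (M : Matrix n n ℝ) :
    (M * ∑ i ∈ s, w i • vecMulVec (v i) (v i)).trace = ∑ i ∈ s, w i * (v i ⬝ᵥ (M *ᵥ v i)) := by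
  simp [Finset.mul_sum, trace_sum, mul_vecMulVec, trace_vecMulVec, dotProduct_comm]

section MatrixInequalities

variable {n : Type*} [Fintype n] [DecidableEq n]

theorem Matrix.PosSemidef.exists_eq_conjTranspose_mul_self {M : Matrix n n ℝ}
    (hM : M.PosSemidef) : ∃ B : Matrix n n ℝ, M = Bᴴ * B := by
  open scoped MatrixOrder in
  exact CStarAlgebra.nonneg_iff_eq_star_mul_self.mp hM.nonneg

theorem Matrix.PosSemidef.trace_mul_nonneg {M S : Matrix n n ℝ} (hM : M.PosSemidef)
    (hS : S.PosSemidef) : 0 ≤ (M * S).trace := by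
  obtain ⟨B, rfl⟩ := hM.exists_eq_conjTranspose_mul_self
  rw [mul_assoc, trace_mul_comm]
  exact (hS.mul_mul_conjTranspose_same B).trace_nonneg

theorem Matrix.PosSemidef.one_add_trace_le_det_one_add {M : Matrix n n ℝ} (hM : M.PosSemidef) :
    1 + M.trace ≤ (1 + M).det := by
  have hdet : (1 + M).det = ∏ i, (1 + hM.1.eigenvalues i) := by
    conv_lhs => rw [hM.1.spectral_theorem, Unitary.conjStarAlgAut_apply, mul_assoc,
      det_one_add_mul_comm, mul_assoc, Unitary.coe_star_mul_self, mul_one, ← diagonal_one,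
      diagonal_add, det_diagonal]
    simp
  rw [hdet, hM.1.trace_eq_sum_eigenvalues]
  simpa using one_add_sum_le_prod_one_add_of_nonneg univ fun i _ => hM.eigenvalues_nonneg i

theorem Matrix.PosDef.det_mul_one_add_trace_le_det_add {V S : Matrix n n ℝ} (hV : V.PosDef)
    (hS : S.PosSemidef) : V.det * (1 + (V⁻¹ * S).trace) ≤ (V + S).det := by
  obtain ⟨B, hB⟩ := hV.inv.posSemidef.exists_eq_conjTranspose_mul_self
  have hunit : IsUnit V.det := hV.det_pos.ne'.isUnit
  have hfactor : V + S = V * (1 + V⁻¹ * S) := by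
    rw [mul_add, mul_one, mul_nonsing_inv_cancel_left _ _ hunit]
  rw [hfactor, det_mul, hB, mul_assoc, trace_mul_comm, det_one_add_mul_comm]
  exact mul_le_mul_of_nonneg_left
    (hS.mul_mul_conjTranspose_same B).one_add_trace_le_det_one_add hV.det_pos.le

theorem Matrix.PosDef.log_det_le {V : Matrix n n ℝ} (hV : V.PosDef) {m : ℝ} (hm : 0 < m)
    (htr : V.trace ≤ Fintype.card n * m) : Real.log V.det ≤ Fintype.card n * Real.log m := by
  have htrace := hV.1.trace_eq_sum_eigenvalues
  have hdet := hV.1.det_eq_prod_eigenvalues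
  simp only [RCLike.ofReal_real_eq_id, id_eq] at htrace hdet
  rw [hdet, Real.log_prod fun i _ => (hV.eigenvalues_pos i).ne']
  calc ∑ i, Real.log (hV.1.eigenvalues i)
      ≤ ∑ i, (hV.1.eigenvalues i / m - 1 + Real.log m) := by
        refine Finset.sum_le_sum fun i _ => ?_
        have := Real.log_le_sub_one_of_pos (div_pos (hV.eigenvalues_pos i) hm)
        rw [Real.log_div (hV.eigenvalues_pos i).ne' hm.ne'] at this
        linarith
    _ = V.trace / m - Fintype.card n + Fintype.card n * Real.log m := by
        rw [htrace, Finset.sum_add_distrib, Finset.sum_sub_distrib, Finset.sum_div]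
        simp
    _ ≤ Fintype.card n * Real.log m := by
        have := (div_le_iff₀ hm).mpr htr
        linarith

theorem Matrix.PosSemidef.dotProduct_one_add_inv_mulVec_le {S : Matrix n n ℝ}
    (hS : S.PosSemidef) (a : n → ℝ) : a ⬝ᵥ ((1 + S)⁻¹ *ᵥ a) ≤ a ⬝ᵥ a := by
  have hV : (1 + S).PosDef := PosDef.one.add_posSemidef hS
  set x := (1 + S)⁻¹ *ᵥ a with hx
  have ha : a = x + S *ᵥ x := by
    have : (1 + S) *ᵥ x = a := by
      rw [hx, mulVec_mulVec, mul_nonsing_inv _ hV.det_pos.ne'.isUnit, one_mulVec]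
    rw [← this, add_mulVec, one_mulVec]
  have hSx : 0 ≤ x ⬝ᵥ (S *ᵥ x) := by simpa using hS.dotProduct_mulVec_nonneg x
  have hsq : 0 ≤ (S *ᵥ x) ⬝ᵥ (S *ᵥ x) := by simpa using dotProduct_star_self_nonneg (S *ᵥ x)
  rw [ha]
  simp only [add_dotProduct, dotProduct_add, dotProduct_comm (S *ᵥ x) x]
  linarith

end MatrixInequalities

theorem Real.le_two_mul_log_one_add {x : ℝ} (h0 : 0 ≤ x) (h1 : x ≤ 1) :
    x ≤ 2 * Real.log (1 + x) := by
  have h := Real.one_sub_inv_le_log_of_pos (by linarith : 0 < 1 + x)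
  have : x / 2 ≤ 1 - (1 + x)⁻¹ := by
    rw [show 1 - (1 + x)⁻¹ = x / (1 + x) by field_simp; ring]
    exact div_le_div_of_nonneg_left h0 (by linarith) (by linarith)
  linarith

/-- The elliptical potential lemma for positive semidefinite increments. -/
theorem Matrix.sum_trace_inv_mul_le_two_mul_log_det {n : Type*} [Fintype n] [DecidableEq n]
    (S : ℕ → Matrix n n ℝ) (t : ℕ) (hS : ∀ i ∈ Icc 1 t, (S i).PosSemidef)
    (hle : ∀ i ∈ Icc 1 t, ((1 + ∑ j ∈ Icc 1 (i - 1), S j)⁻¹ * S i).trace ≤ 1) :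
    ∑ i ∈ Icc 1 t, ((1 + ∑ j ∈ Icc 1 (i - 1), S j)⁻¹ * S i).trace ≤
      2 * Real.log (1 + ∑ j ∈ Icc 1 t, S j).det := by
  induction t with
  | zero => simp
  | succ t ih =>
    have hsub : Icc 1 t ⊆ Icc 1 (t + 1) := Icc_subset_Icc_right t.le_succ
    have hmem : t + 1 ∈ Icc 1 (t + 1) := by simp
    have ih := ih (fun i hi => hS i (hsub hi)) fun i hi => hle i (hsub hi)
    have hV : (1 + ∑ j ∈ Icc 1 t, S j).PosDef :=
      PosDef.one.add_posSemidef (posSemidef_sum _ fun i hi => hS i (hsub hi))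
    have hlast := hle _ hmem
    rw [sum_Icc_succ_top (by omega), sum_Icc_succ_top (by omega), ← add_assoc]
    rw [Nat.add_sub_cancel] at hlast ⊢
    set V := 1 + ∑ j ∈ Icc 1 t, S j
    have hnonneg : 0 ≤ (V⁻¹ * S (t + 1)).trace :=
      hV.inv.posSemidef.trace_mul_nonneg (hS _ hmem)
    have hlog := Real.log_le_log (mul_pos hV.det_pos (by linarith))
      (hV.det_mul_one_add_trace_le_det_add (hS _ hmem))
    rw [Real.log_mul hV.det_pos.ne' (by linarith)] at hlog
    linarith [Real.le_two_mul_log_one_add hnonneg hlast]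

theorem Finset.sum_mul_sqrt_le_sqrt_sum_mul_sum {ι : Type*} (s : Finset ι) (w q : ι → ℝ)
    (hw : ∀ i ∈ s, 0 ≤ w i) (hq : ∀ i ∈ s, 0 ≤ q i) :
    ∑ i ∈ s, w i * √(q i) ≤ √((∑ i ∈ s, w i) * ∑ i ∈ s, w i * q i) := by
  refine Real.le_sqrt_of_sq_le (sum_sq_le_sum_mul_sum_of_sq_le_mul s hw
    (fun i hi => mul_nonneg (hw i hi) (hq i hi)) fun i hi => ?_)
  rw [mul_pow, Real.sq_sqrt (hq i hi)]
  exact (by ring : w i ^ 2 * q i = w i * (w i * q i)).le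

/-- Sequential-design potential inequality (from the proof of Lemma C.7 of Qiao–Wang):
for probability mass functions `ν_1, ..., ν_t` on a finite set `Φ` of unit-norm-bounded
vectors, with `Σ_i = ∑_{j≤i} E_{a∼ν_j}[a aᵀ]`,
`∑_{i=1}^t E_{a∼ν_i}[√(aᵀ (I + Σ_{i-1})⁻¹ a)] ≤ √(2 d t log(1 + t/d))`. -/
theorem sequential_design_potential {d t : ℕ} (hd : 0 < d) (ht : 0 < t)
    (Φ : Finset (Fin d → ℝ)) (hΦ : ∀ a ∈ Φ, Real.sqrt (a ⬝ᵥ a) ≤ 1)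
    (ν : ℕ → (Fin d → ℝ) → ℝ)
    (hνnonneg : ∀ i ∈ Finset.Icc 1 t, ∀ a ∈ Φ, 0 ≤ ν i a)
    (hνsum : ∀ i ∈ Finset.Icc 1 t, ∑ a ∈ Φ, ν i a = 1) :
    ∑ i ∈ Finset.Icc 1 t, ∑ a ∈ Φ,
        ν i a *
          Real.sqrt
            (a ⬝ᵥ ((1 + ∑ j ∈ Finset.Icc 1 (i - 1), ∑ a' ∈ Φ, ν j a' • vecMulVec a' a')⁻¹
              *ᵥ a)) ≤
      Real.sqrt (2 * d * t * Real.log (1 + (t : ℝ) / d)) := by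
  have hd' : (0 : ℝ) < d := by exact_mod_cast hd
  have hnorm : ∀ a ∈ Φ, a ⬝ᵥ a ≤ 1 := fun a ha => by simpa using Real.sqrt_le_iff.mp (hΦ a ha)
  set S : ℕ → Matrix (Fin d) (Fin d) ℝ := fun j => ∑ a ∈ Φ, ν j a • vecMulVec a a with hSdef
  have hS : ∀ i ∈ Icc 1 t, (S i).PosSemidef := fun i hi =>
    posSemidef_sum_smul_vecMulVec Φ (ν i) id (hνnonneg i hi)
  have hpartial : ∀ i ≤ t, (∑ j ∈ Icc 1 i, S j).PosSemidef := fun i hi =>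
    posSemidef_sum _ fun j hj => hS j (Icc_subset_Icc_right hi hj)
  have hpred : ∀ i ∈ Icc 1 t, i - 1 ≤ t := fun i hi => by
    have := (mem_Icc.mp hi).2
    omega
  have hexp : ∀ i (M : Matrix (Fin d) (Fin d) ℝ),
      (M * S i).trace = ∑ a ∈ Φ, ν i a * (a ⬝ᵥ (M *ᵥ a)) := fun i M =>
    trace_mul_sum_smul_vecMulVec Φ (ν i) id M
  have hmean : ∀ i ∈ Icc 1 t, ∀ q : (Fin d → ℝ) → ℝ, (∀ a ∈ Φ, q a ≤ 1) →
      ∑ a ∈ Φ, ν i a * q a ≤ 1 := fun i hi q hq => by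
    rw [← hνsum i hi]
    exact sum_le_sum fun a ha => mul_le_of_le_one_right (hνnonneg i hi a ha) (hq a ha)
  have hpotential := sum_trace_inv_mul_le_two_mul_log_det S t hS fun i hi => by
    rw [hexp]
    exact hmean i hi _ fun a ha =>
      ((hpartial _ (hpred i hi)).dotProduct_one_add_inv_mulVec_le a).trans (hnorm a ha)
  have htrace : (1 + ∑ j ∈ Icc 1 t, S j).trace ≤
      Fintype.card (Fin d) * (1 + (t : ℝ) / d) := by
    have hsum : ∑ j ∈ Icc 1 t, (S j).trace ≤ ∑ j ∈ Icc 1 t, (1 : ℝ) :=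
      sum_le_sum fun j hj => by
        rw [← one_mul (S j), hexp]
        exact hmean j hj _ fun a ha => by simpa using hnorm a ha
    rw [trace_add, trace_one, trace_sum, Fintype.card_fin, mul_add, mul_one,
      mul_div_cancel₀ _ hd'.ne']
    simpa using hsum
  have hlog := (PosDef.one.add_posSemidef (hpartial t le_rfl)).log_det_le
    (by positivity : 0 < 1 + (t : ℝ) / d) htrace
  rw [Fintype.card_fin] at hlog
  rw [← sum_product']
  refine (sum_mul_sqrt_le_sqrt_sum_mul_sum (Icc 1 t ×ˢ Φ) (fun p => ν p.1 p.2)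
    (fun p => p.2 ⬝ᵥ ((1 + ∑ j ∈ Icc 1 (p.1 - 1), S j)⁻¹ *ᵥ p.2)) ?_ ?_).trans
    (Real.sqrt_le_sqrt ?_)
  · exact fun p hp => hνnonneg _ (mem_product.mp hp).1 _ (mem_product.mp hp).2
  · intro p hp
    simpa using (PosDef.one.add_posSemidef (hpartial _ (hpred _ (mem_product.mp hp).1))).inv
      |>.posSemidef.dotProduct_mulVec_nonneg p.2
  · rw [sum_product, sum_product, sum_congr rfl hνsum]
    simp only [← hexp]
    calc _ ≤ (t : ℝ) * (2 * (d * Real.log (1 + (t : ℝ) / d))) := by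
          simp only [sum_const, Nat.card_Icc, nsmul_eq_mul, mul_one, Nat.add_sub_cancel]
          gcongr
          linarith
      _ = _ := by ring
end
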